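/- Let B be a finite list of bids on n goods whose indirect utility function f_B is convex on ℝ^n, and let t ∈ ℤ^n with t ≥ 0. Define the Lyapunov function g(p) := f_B(p) + t·p. Then g restricted to ℤ^n_{≥0} satisfies translation submodularity: for all p, q ∈ ℤ^n with p ≥ 0 and q ≥ 0 and every integer α ≥ 0, g(p) + g(q) ≥ g((p − α·1) ∨ q) + g(p ∧ (q + α·1)), where 1 is the all-ones vector and ∨, ∧ denote componentwise maximum and minimum. In other words, g restricted to ℤ^n_{≥0} is L♮-convex. -/

import Mathlib

open Finset

noncomputable section

variable {n : ℕ}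

/-- Extend a value/price vector in `ℝ^n` by a 0-th coordinate (the reject good) equal to 0. -/
def extVec (b : Fin n → ℝ) : Fin (n + 1) → ℝ := Fin.cons 0 b

/-- Surplus of good `i` (in `{0,…,n}`) for value vector `b` at price `p`. -/
def surplus (b p : Fin n → ℝ) (i : Fin (n + 1)) : ℝ := extVec b i - extVec p i

/-- Maximal surplus over all goods (including the reject good). -/
def maxSurplus (b p : Fin n → ℝ) : ℝ :=
  Finset.univ.sup' Finset.univ_nonempty (surplus b p)

/-- The bid with value vector `b` demands good `i` at price `p`. -/
def Demands (b p : Fin n → ℝ) (i : Fin (n + 1)) : Prop :=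
  ∀ j, surplus b p j ≤ surplus b p i

open Classical in
/-- The set of goods demanded by value vector `b` at price `p`. -/
def demandedSet (b p : Fin n → ℝ) : Finset (Fin (n + 1)) :=
  Finset.univ.filter fun i => Demands b p i

/-- Indirect utility function of a bid list (bids are pairs of value vector and weight). -/
def indirectUtility (B : List ((Fin n → ℝ) × ℝ)) (p : Fin n → ℝ) : ℝ :=
  (B.map fun bw => bw.2 * maxSurplus bw.1 p).sum

/-- Surplus gap of the bid `b` at `p`: maximal surplus minus the best surplus on
a non-demanded good (junk value when every good is demanded). -/
def surplusGap (b p : Fin n → ℝ) : ℝ :=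
  maxSurplus b p - sSup (surplus b p '' {i | i ∉ demandedSet b p})

/-- `B` is `ε`-valid at `p` if its indirect utility function is convex on the open
`L∞`-ball of radius `ε` around `p`. -/
def epsValid (B : List ((Fin n → ℝ) × ℝ)) (p : Fin n → ℝ) (ε : ℝ) : Prop :=
  ConvexOn ℝ {q : Fin n → ℝ | ‖q - p‖ < ε} (indirectUtility B)

open Classical in
/-- Sum of the weights of bids in `B` that are marginal on both `i` and `i'` at `p`. -/
def marginalWeight (B : List ((Fin n → ℝ) × ℝ)) (p : Fin n → ℝ) (i i' : Fin (n + 1)) : ℝ :=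
  (B.map fun bw => if Demands bw.1 p i ∧ Demands bw.1 p i' then bw.2 else 0).sum


/-- The Lyapunov function `g(p) = f_B(p) + t·p` evaluated at an integer price vector. -/
def lyapunov (B : List ((Fin n → ℝ) × ℝ)) (t : Fin n → ℤ) (p : Fin n → ℤ) : ℝ :=
  indirectUtility B (fun i => (p i : ℝ)) + ∑ i, (t i : ℝ) * (p i : ℝ)

/-- A function that does not increase across intervals free of points of a finite set is antitone. -/
theorem antitone_of_forall_free_interval (K : Finset ℝ) (D : ℝ → ℝ) (lo hi : ℝ)
    (hD : ∀ a b, lo ≤ a → a ≤ b → b ≤ hi → (∀ k ∈ K, k ≤ a ∨ b ≤ k) → D b ≤ D a)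
    (a b : ℝ) (ha : lo ≤ a) (hab : a ≤ b) (hb : b ≤ hi) : D b ≤ D a := by
  induction K using Finset.induction_on generalizing lo hi a b with
  | empty => exact hD a b ha hab hb (by simp)
  | insert k K _ ih =>
    have free : ∀ a b, lo ≤ a → a ≤ b → b ≤ hi → (k ≤ a ∨ b ≤ k) → D b ≤ D a := by
      intro a b ha hab hb hk
      refine ih a b (fun a' b' ha' hab' hb' hK => ?_) a b le_rfl hab le_rfl
      refine hD a' b' (ha.trans ha') hab' (hb'.trans hb) fun k' hk' => ?_
      rcases Finset.mem_insert.1 hk' with rfl | hk'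
      · exact hk.imp (fun h => h.trans ha') (fun h => hb'.trans h)
      · exact hK k' hk'
    rcases le_total k a with h | h
    · exact free a b ha hab hb (Or.inl h)
    rcases le_total b k with h' | h'
    · exact free a b ha hab hb (Or.inr h')
    · exact (free k b (ha.trans h) h' hb (Or.inl le_rfl)).trans
        (free a k ha h (h'.trans hb) (Or.inr le_rfl))

/-- On a rectangle not crossed by the kinks `s = u - c` and `t = v - c`, moving two opposite
corners diagonally towards each other does not change the sum of the values there. -/
theorem max_add_max_diagonal {c u v s₀ s₁ t₀ t₁ κ : ℝ} (hκ : 0 ≤ κ) (hs : κ ≤ s₁ - s₀)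
    (ht : κ ≤ t₁ - t₀) (hu : u - c ≤ s₀ ∨ s₁ ≤ u - c) (hv : v - c ≤ t₀ ∨ t₁ ≤ v - c) :
    max c (max (u - (s₀ + κ)) (v - (t₀ + κ))) + max c (max (u - (s₁ - κ)) (v - (t₁ - κ))) =
      max c (max (u - s₀) (v - t₀)) + max c (max (u - s₁) (v - t₁)) := by
  rcases hu with hu | hu <;> rcases hv with hv | hv
  · repeat rw [max_eq_left (max_le (by linarith) (by linarith))]
  · have key : ∀ s t, s₀ ≤ s → t ≤ t₁ → max c (max (u - s) (v - t)) = v - t := fun s t _ _ => by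
      rw [max_eq_right (a := u - s) (by linarith), max_eq_right (by linarith)]
    rw [key _ _ (by linarith) (by linarith), key _ _ (by linarith) (by linarith),
      key _ _ (by linarith) (by linarith), key _ _ (by linarith) (by linarith)]
    ring
  · have key : ∀ s t, s ≤ s₁ → t₀ ≤ t → max c (max (u - s) (v - t)) = u - s := fun s t _ _ => by
      rw [max_eq_left (b := v - t) (by linarith), max_eq_right (by linarith)]
    rw [key _ _ (by linarith) (by linarith), key _ _ (by linarith) (by linarith),
      key _ _ (by linarith) (by linarith), key _ _ (by linarith) (by linarith)]
    ring
  · have key : ∀ s t, s ≤ s₁ → max c (max (u - s) (v - t)) = max (u - s) (v - t) :=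
      fun s t _ => max_eq_right (le_max_of_le_left (by linarith))
    rw [key _ _ (by linarith), key _ _ (by linarith), key _ _ (by linarith), key _ _ (by linarith),
      show u - (s₀ + κ) = u - s₀ - κ by ring, show v - (t₀ + κ) = v - t₀ - κ by ring,
      show u - (s₁ - κ) = u - s₁ + κ by ring, show v - (t₁ - κ) = v - t₁ + κ by ring,
      max_sub_sub_right, max_add_add_right]
    ring

/-- Planar submodularity: a signed sum of functions `max c (u - s) (v - t)` that satisfies the
convexity inequality on antidiagonals of rectangles has nonpositive mixed differences. -/
theorem mixed_difference_nonpos {α : Type*} (B : List α) (w c u v : α → ℝ) (h : ℝ → ℝ → ℝ)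
    {S T : ℝ} (hS : 0 ≤ S) (hT : 0 ≤ T)
    (hh : ∀ s t, s ≤ S →
      h s t = (B.map fun β => w β * max (c β) (max (u β - s) (v β - t))).sum)
    (hconv : ∀ s₀ s₁ t₀ t₁ : ℝ, s₀ ≤ s₁ → t₀ ≤ t₁ → ∃ κ, 0 ≤ κ ∧ κ ≤ s₁ - s₀ ∧ κ ≤ t₁ - t₀ ∧
      h (s₀ + κ) (t₀ + κ) + h (s₁ - κ) (t₁ - κ) ≤ h s₁ t₀ + h s₀ t₁) :
    h 0 0 + h S T ≤ h S 0 + h 0 T := by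
  have cell : ∀ s₀ s₁ t₀ t₁, s₀ ≤ s₁ → s₁ ≤ S → t₀ ≤ t₁ →
      (∀ k ∈ (B.map fun β => u β - c β).toFinset, k ≤ s₀ ∨ s₁ ≤ k) →
      (∀ k ∈ (B.map fun β => v β - c β).toFinset, k ≤ t₀ ∨ t₁ ≤ k) →
      h s₀ t₀ + h s₁ t₁ ≤ h s₁ t₀ + h s₀ t₁ := by
    intro s₀ s₁ t₀ t₁ hs hsS ht hu hv
    obtain ⟨κ, h0, h1, h2, hle⟩ := hconv s₀ s₁ t₀ t₁ hs ht
    refine le_trans (le_of_eq ?_) hle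
    rw [hh _ _ (hs.trans hsS), hh _ _ hsS,
      hh _ _ (by linarith), hh _ _ (by linarith),
      ← List.sum_map_add, ← List.sum_map_add]
    refine congrArg List.sum (List.map_congr_left fun β hβ => ?_)
    rw [← mul_add, ← mul_add, max_add_max_diagonal h0 h1 h2
      (hu _ (by simpa using ⟨β, hβ, rfl⟩)) (hv _ (by simpa using ⟨β, hβ, rfl⟩))]
  have strip : ∀ s₀ s₁, s₀ ≤ s₁ → s₁ ≤ S →
      (∀ k ∈ (B.map fun β => u β - c β).toFinset, k ≤ s₀ ∨ s₁ ≤ k) →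
      h s₁ T - h s₀ T ≤ h s₁ 0 - h s₀ 0 := by
    intro s₀ s₁ hs hsS hu
    refine antitone_of_forall_free_interval (B.map fun β => v β - c β).toFinset
      (fun t => h s₁ t - h s₀ t) 0 T (fun t₀ t₁ _ ht _ hv => ?_) 0 T le_rfl hT le_rfl
    linarith [cell s₀ s₁ t₀ t₁ hs hsS ht hu hv]
  have := antitone_of_forall_free_interval (B.map fun β => u β - c β).toFinset
    (fun s => h s T - h s 0) 0 S
    (fun s₀ s₁ _ hs hsS hu => by linarith [strip s₀ s₁ hs hsS hu]) 0 S le_rfl hS le_rfl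
  linarith

/-- A function on `ι → ℝ` with nonpositive mixed differences is submodular. -/
theorem submodular_of_mixed_difference_nonpos {ι : Type*} [Fintype ι] [DecidableEq ι]
    (G : (ι → ℝ) → ℝ)
    (hG : ∀ x i j, i ≠ j → ∀ s t : ℝ, 0 ≤ s → 0 ≤ t →
      G x + G (x + Pi.single i s + Pi.single j t) ≤
        G (x + Pi.single i s) + G (x + Pi.single j t)) (x y : ι → ℝ) :
    G (x ⊔ y) + G (x ⊓ y) ≤ G x + G y := by
  have single : ∀ x i (s : ℝ) (b : ι → ℝ), 0 ≤ s → 0 ≤ b → (s = 0 ∨ b i = 0) →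
      G x + G (x + Pi.single i s + b) ≤ G (x + Pi.single i s) + G (x + b) := by
    intro x i s b hs hb hi
    have key : ∀ A : Finset ι, G x + G (x + Pi.single i s + ∑ j ∈ A, Pi.single j (b j)) ≤
        G (x + Pi.single i s) + G (x + ∑ j ∈ A, Pi.single j (b j)) := by
      intro A
      induction A using Finset.induction_on with
      | empty => simp [add_comm]
      | insert j A hj ih =>
        rw [Finset.sum_insert hj, add_comm (Pi.single j (b j) : ι → ℝ)]
        by_cases hij : i = j
        · subst hij
          rcases hi with h | h <;> simp_all
        · have := hG (x + ∑ j ∈ A, Pi.single j (b j)) i j hij s (b j) hs (hb j)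
          rw [add_right_comm x _ (Pi.single i s)] at this
          rw [← add_assoc, ← add_assoc]
          linarith
    simpa only [Finset.univ_sum_single] using key univ
  have general : ∀ x (a b : ι → ℝ), 0 ≤ a → 0 ≤ b → (∀ i, a i = 0 ∨ b i = 0) →
      G x + G (x + a + b) ≤ G (x + a) + G (x + b) := by
    intro x a b ha hb hab
    have key : ∀ A : Finset ι, G x + G (x + ∑ j ∈ A, Pi.single j (a j) + b) ≤
        G (x + ∑ j ∈ A, Pi.single j (a j)) + G (x + b) := by
      intro A
      induction A using Finset.induction_on with
      | empty => simp
      | insert j A hj ih =>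
        rw [Finset.sum_insert hj, add_comm (Pi.single j (a j) : ι → ℝ), ← add_assoc]
        have := single (x + ∑ j ∈ A, Pi.single j (a j)) j (a j) b (ha j) hb (hab j)
        linarith
    simpa only [Finset.univ_sum_single] using key univ
  have := general (x ⊓ y) (x - x ⊓ y) (y - x ⊓ y) (sub_nonneg.2 inf_le_left)
    (sub_nonneg.2 inf_le_right) fun i => by
      rcases le_total (x i) (y i) with h | h <;> simp [h]
  rw [add_sub_cancel, add_sub_cancel, ← add_sub_assoc, ← inf_add_sup x y,
    add_sub_cancel_left] at this
  linarith

/-- Sum of two values of a convex function at points placed symmetrically on a segment. -/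
theorem ConvexOn.add_symm_le {E : Type*} [AddCommGroup E] [Module ℝ E] {F : E → ℝ}
    (hF : ConvexOn ℝ Set.univ F) (x y : E) {a b : ℝ} (ha : 0 ≤ a) (hb : 0 ≤ b) (hab : a + b = 1) :
    F (a • x + b • y) + F (b • x + a • y) ≤ F x + F y := by
  have h1 := hF.2 (Set.mem_univ x) (Set.mem_univ y) ha hb hab
  have h2 := hF.2 (Set.mem_univ x) (Set.mem_univ y) hb ha (by linarith)
  simp only [smul_eq_mul] at h1 h2
  obtain rfl : b = 1 - a := by linarith
  linarith

/-- The indirect utility function with a free price for the reject good. -/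
def homogeneousUtility (B : List ((Fin n → ℝ) × ℝ)) (x : Fin (n + 1) → ℝ) : ℝ :=
  (B.map fun bw => bw.2 * univ.sup' univ_nonempty fun k => extVec bw.1 k - x k).sum

theorem homogeneousUtility_cons (B : List ((Fin n → ℝ) × ℝ)) (a : ℝ) (p : Fin n → ℝ) :
    homogeneousUtility B (Fin.cons a fun i => p i + a) =
      indirectUtility B p - a * (B.map fun bw => bw.2).sum := by
  have hmax : ∀ b : Fin n → ℝ, (univ.sup' univ_nonempty fun k =>
      extVec b k - (Fin.cons a (fun i => p i + a) : Fin (n + 1) → ℝ) k) =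
        maxSurplus b p - a := by
    intro b
    have hk : ∀ k, extVec b k - (Fin.cons a (fun i => p i + a) : Fin (n + 1) → ℝ) k =
        surplus b p k - a := by
      intro k
      refine Fin.cases ?_ (fun i => ?_) k <;> simp [surplus, extVec]
      ring
    simp only [hk]
    exact (Finset.apply_sup'_eq_sup'_comp (s := univ) univ_nonempty (fun r : ℝ => r - a)
      (fun r₁ r₂ => (max_sub_sub_right r₁ r₂ a).symm)).symm
  simp only [homogeneousUtility, indirectUtility, hmax]
  induction B with
  | nil => simp
  | cons bw B ih => simp only [List.map_cons, List.sum_cons, ih]; ring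

theorem convexOn_homogeneousUtility (B : List ((Fin n → ℝ) × ℝ))
    (hconv : ConvexOn ℝ Set.univ (indirectUtility B)) :
    ConvexOn ℝ Set.univ (homogeneousUtility B) := by
  have heq : ∀ x, homogeneousUtility B x =
      indirectUtility B (fun i => x i.succ - x 0) - x 0 * (B.map fun bw => bw.2).sum := by
    intro x
    rw [← homogeneousUtility_cons]
    congr 1
    ext k
    refine Fin.cases ?_ (fun i => ?_) k <;> simp
  refine ⟨convex_univ, fun x _ y _ a b ha hb hab => ?_⟩
  have h := hconv.2 (Set.mem_univ fun i => x (Fin.succ i) - x 0)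
    (Set.mem_univ fun i => y (Fin.succ i) - y 0) ha hb hab
  have harg : (fun i : Fin n => (a • x + b • y) i.succ - (a • x + b • y) 0) =
      a • (fun i => x (Fin.succ i) - x 0) + b • fun i => y (Fin.succ i) - y 0 := by
    ext i
    simp
    ring
  rw [heq, heq, heq, harg]
  simp only [smul_eq_mul, Pi.add_apply, Pi.smul_apply] at h ⊢
  linarith

/-- Along two coordinates the maximum is a maximum of three terms,
provided the shift of the first one is bounded. -/
theorem sup'_sub_single_single {ι : Type*} [Fintype ι] [Nonempty ι] [DecidableEq ι]
    (d : ι → ℝ) {i j : ι} (hij : i ≠ j) {S s t : ℝ} (hs : s ≤ S) :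
    (univ.sup' univ_nonempty fun k =>
        d k - ((Pi.single i s : ι → ℝ) k + (Pi.single j t : ι → ℝ) k)) =
      max (univ.sup' univ_nonempty fun k =>
        if k = i ∨ k = j then d i - S else d k) (max (d i - s) (d j - t)) := by
  apply le_antisymm
  · refine Finset.sup'_le _ _ fun k _ => ?_
    by_cases hi : k = i
    · subst hi
      simp [hij]
    by_cases hj : k = j
    · subst hj
      simp [hi]
    · refine le_max_of_le_left (le_trans ?_ (Finset.le_sup' _ (mem_univ k)))
      simp [hi, hj]
  · have hi := Finset.le_sup' (fun k =>
      d k - ((Pi.single i s : ι → ℝ) k + (Pi.single j t : ι → ℝ) k)) (mem_univ i)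
    have hj := Finset.le_sup' (fun k =>
      d k - ((Pi.single i s : ι → ℝ) k + (Pi.single j t : ι → ℝ) k)) (mem_univ j)
    simp only [Pi.single_eq_same, Pi.single_eq_of_ne hij, Pi.single_eq_of_ne hij.symm, add_zero,
      zero_add] at hi hj
    refine max_le (Finset.sup'_le _ _ fun k _ => ?_) (max_le hi hj)
    split_ifs with hk
    · exact (sub_le_sub_left hs _).trans hi
    · push Not at hk
      refine le_trans ?_ (Finset.le_sup' _ (mem_univ k))
      simp [hk.1, hk.2]

theorem homogeneousUtility_mixed_difference_nonpos (B : List ((Fin n → ℝ) × ℝ))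
    (hconv : ConvexOn ℝ Set.univ (indirectUtility B)) (x : Fin (n + 1) → ℝ) (i j : Fin (n + 1))
    (hij : i ≠ j) (S T : ℝ) (hS : 0 ≤ S) (hT : 0 ≤ T) :
    homogeneousUtility B x + homogeneousUtility B (x + Pi.single i S + Pi.single j T) ≤
      homogeneousUtility B (x + Pi.single i S) + homogeneousUtility B (x + Pi.single j T) := by
  have main := mixed_difference_nonpos B (fun bw => bw.2)
    (fun bw => univ.sup' univ_nonempty fun k => if k = i ∨ k = j then
      extVec bw.1 i - x i - S else extVec bw.1 k - x k)
    (fun bw => extVec bw.1 i - x i) (fun bw => extVec bw.1 j - x j)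
    (fun s t => homogeneousUtility B (x + Pi.single i s + Pi.single j t)) hS hT ?_ ?_
  · simpa using main
  · intro s t hs
    refine congrArg List.sum (List.map_congr_left fun bw _ => ?_)
    rw [← sup'_sub_single_single (fun k => extVec bw.1 k - x k) hij hs]
    simp only [Pi.add_apply, add_assoc, sub_sub]
  · intro s₀ s₁ t₀ t₁ hs ht
    rcases hs.eq_or_lt with rfl | hs
    · exact ⟨0, le_rfl, by simp, by simpa using ht, by simp⟩
    have hpos : 0 < (s₁ - s₀) + (t₁ - t₀) := by linarith
    have ha : 0 ≤ (t₁ - t₀) / ((s₁ - s₀) + (t₁ - t₀)) := div_nonneg (by linarith) hpos.le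
    have hb : 0 ≤ (s₁ - s₀) / ((s₁ - s₀) + (t₁ - t₀)) := div_nonneg (by linarith) hpos.le
    have hab : (t₁ - t₀) / ((s₁ - s₀) + (t₁ - t₀)) + (s₁ - s₀) / ((s₁ - s₀) + (t₁ - t₀)) = 1 := by
      field_simp
      ring
    have hκ : (t₁ - t₀) / ((s₁ - s₀) + (t₁ - t₀)) * (s₁ - s₀) =
        (s₁ - s₀) / ((s₁ - s₀) + (t₁ - t₀)) * (t₁ - t₀) := by ring
    generalize (t₁ - t₀) / ((s₁ - s₀) + (t₁ - t₀)) = a at ha hab hκ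
    generalize (s₁ - s₀) / ((s₁ - s₀) + (t₁ - t₀)) = b at hb hab hκ
    refine ⟨a * (s₁ - s₀), by nlinarith, by nlinarith, by nlinarith, ?_⟩
    have hc := (convexOn_homogeneousUtility B hconv).add_symm_le
      (x + Pi.single i s₁ + Pi.single j t₀) (x + Pi.single i s₀ + Pi.single j t₁) ha hb hab
    have comb : ∀ a b : ℝ, a + b = 1 →
        a • (x + Pi.single i s₁ + Pi.single j t₀) + b • (x + Pi.single i s₀ + Pi.single j t₁) =
          x + Pi.single i (a * s₁ + b * s₀) + Pi.single j (a * t₀ + b * t₁) := by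
      intro a b hab
      simp only [Pi.single_add, ← smul_eq_mul, Pi.single_smul']
      obtain rfl : b = 1 - a := by linarith
      module
    rw [comb a b hab, comb b a (by linarith)] at hc
    obtain rfl : b = 1 - a := by linarith
    rw [show a * s₁ + (1 - a) * s₀ = s₀ + a * (s₁ - s₀) by ring,
      show a * t₀ + (1 - a) * t₁ = t₀ + a * (s₁ - s₀) by linarith,
      show (1 - a) * s₁ + a * s₀ = s₁ - a * (s₁ - s₀) by ring,
      show (1 - a) * t₀ + a * t₁ = t₁ - a * (s₁ - s₀) by linarith] at hc
    exact hc

/-- If the indirect utility function `f_B` of a bid list `B` is convex on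
`ℝ^n` and `t ∈ ℤ^n` with `t ≥ 0`, then the Lyapunov function `g(p) = f_B(p) + t·p`
restricted to `ℤ^n_{≥0}` satisfies translation submodularity (i.e. it is `L♮`-convex):
`g(p) + g(q) ≥ g((p − α·1) ∨ q) + g(p ∧ (q + α·1))` for all `p, q ∈ ℤ^n_{≥0}` and all
integers `α ≥ 0`. -/
theorem stmt8 (n : ℕ) (hn : 1 ≤ n) (B : List ((Fin n → ℝ) × ℝ))
    (hw : ∀ bw ∈ B, bw.2 = 1 ∨ bw.2 = -1)
    (hconv : ConvexOn ℝ Set.univ (indirectUtility B))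
    (t : Fin n → ℤ) (ht : ∀ i, 0 ≤ t i) :
    ∀ p q : Fin n → ℤ, (∀ i, 0 ≤ p i) → (∀ i, 0 ≤ q i) → ∀ α : ℤ, 0 ≤ α →
      lyapunov B t (fun i => max (p i - α) (q i)) +
          lyapunov B t (fun i => min (p i) (q i + α)) ≤
        lyapunov B t p + lyapunov B t q := by
  intro p q _ _ α hα
  have hsub := submodular_of_mixed_difference_nonpos (homogeneousUtility B)
    (homogeneousUtility_mixed_difference_nonpos B hconv)
    (Fin.cons (-α : ℝ) fun i => (p i : ℝ) + -α) (Fin.cons 0 fun i => (q i : ℝ) + 0)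
  have hα' : (0 : ℝ) ≤ α := by exact_mod_cast hα
  have hsup : (Fin.cons (-α : ℝ) (fun i => (p i : ℝ) + -α) : Fin (n + 1) → ℝ) ⊔
      Fin.cons 0 (fun i => (q i : ℝ) + 0) =
        Fin.cons 0 fun i => ((max (p i - α) (q i) : ℤ) : ℝ) + 0 := by
    ext k
    refine Fin.cases ?_ (fun i => ?_) k
    · simpa using hα'
    · simp [sub_eq_add_neg]
  have hinf : (Fin.cons (-α : ℝ) (fun i => (p i : ℝ) + -α) : Fin (n + 1) → ℝ) ⊓
      Fin.cons 0 (fun i => (q i : ℝ) + 0) =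
        Fin.cons (-α : ℝ) fun i => ((min (p i) (q i + α) : ℤ) : ℝ) + -α := by
    ext k
    refine Fin.cases ?_ (fun i => ?_) k
    · simpa using hα'
    · simp [← min_add_add_right]
  rw [hsup, hinf] at hsub
  simp only [homogeneousUtility_cons] at hsub
  have hlin : ∑ i, (t i : ℝ) * ((max (p i - α) (q i) : ℤ) : ℝ) +
      ∑ i, (t i : ℝ) * ((min (p i) (q i + α) : ℤ) : ℝ) =
        ∑ i, (t i : ℝ) * (p i : ℝ) + ∑ i, (t i : ℝ) * (q i : ℝ) := by
    rw [← Finset.sum_add_distrib, ← Finset.sum_add_distrib]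
    refine Finset.sum_congr rfl fun i _ => ?_
    rw [← mul_add, ← mul_add, ← Int.cast_add, ← Int.cast_add]
    congr 2
    omega
  simp only [lyapunov]
  linarith

end
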